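/- arXiv:2201.07027 — 3 statements merged into one kernel-verified Lean document; each statement's English description precedes it below -/
import Mathlib

section
/- Let q : Y → X be an irreducible quotient map from a standard space Y to a Hausdorff space X, and let E = q({y ∈ Y : q⁻¹(q(y)) = {y}}) be the image in X of the set of singleton fibres of q. Then E is sequentially dense in X, every point of E is of compact type, and X and E satisfy property (a) and property (b). -/
open Filter Topology Set TopologicalSpace

universe u v w

/-- A quotient map: surjective, continuous, and a set is open iff its preimage is open. -/
def IsQuotMap {Y : Type u} {X : Type v} [TopologicalSpace Y] [TopologicalSpace X]
    (q : Y → X) : Prop :=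
  Function.Surjective q ∧ Continuous q ∧ ∀ s : Set X, IsOpen s ↔ IsOpen (q ⁻¹' s)

/-- An irreducible map: no proper closed subset of the domain maps onto all of `X`. -/
def IsIrreducibleMap {Y : Type u} {X : Type v} [TopologicalSpace Y] (q : Y → X) : Prop :=
  ∀ V : Set Y, IsClosed V → q '' V = Set.univ → V = Set.univ

/-- A pure quotient map. -/
def IsPureQuotMap {Y : Type u} {X : Type v} [TopologicalSpace Y] [TopologicalSpace X]
    (q : Y → X) : Prop :=
  IsQuotMap q ∧
    ∃ D : Set Y, Dense D ∧ Set.InjOn q D ∧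
      ∀ (ι : Type w) (_ : Preorder ι) (_ : Nonempty ι), IsDirected ι (· ≤ ·) →
        ∀ d e : ι → Y, (∀ i, d i ∈ D) → (∀ i, q (d i) = q (e i)) →
          Filter.Tendsto d Filter.atTop (Filter.cocompact Y) →
          Filter.Tendsto e Filter.atTop (Filter.cocompact Y)

/-- `x` is a k-point. -/
def IsKPoint {X : Type v} [TopologicalSpace X] (x : X) : Prop :=
  ∀ E : Set X, x ∈ closure E → ∃ K : Set X, IsCompact K ∧ x ∈ closure (E ∩ K)

/-- A full subset: closed and mapping onto all of `X`. -/
def IsFull {Y : Type u} {X : Type v} [TopologicalSpace Y] (q : Y → X) (W : Set Y) : Prop :=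
  IsClosed W ∧ q '' W = Set.univ

/-- A minimal full subset. -/
def IsMinFull {Y : Type u} {X : Type v} [TopologicalSpace Y] (q : Y → X) (W : Set Y) : Prop :=
  IsFull q W ∧ ∀ Z ⊆ W, IsFull q Z → Z = W

/-- `y` is a singleton fibre of `q`. -/
def SingletonFibre {Y : Type u} {X : Type v} (q : Y → X) (y : Y) : Prop :=
  q ⁻¹' {q y} = {y}

/-- A sequentially dense subset of `X`. -/
def SeqDense {X : Type v} [TopologicalSpace X] (E : Set X) : Prop :=
  ∀ x : X, ∃ u : ℕ → X, (∀ n, u n ∈ E) ∧ Filter.Tendsto u Filter.atTop (nhds x)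

/-- A point of compact type. -/
def CompactType {X : Type v} [TopologicalSpace X] (x : X) : Prop :=
  ∃ K : Set X, IsCompact K ∧
    ∀ u : ℕ → X, Filter.Tendsto u Filter.atTop (nhds x) → ∀ᶠ n in Filter.atTop, u n ∈ K

/-- Convergence of a sequence of closed sets in the Fell topology. -/
def FellConv {Y : Type u} [TopologicalSpace Y] (F : ℕ → Set Y) (L : Set Y) : Prop :=
  (∀ U : Set Y, IsOpen U → (U ∩ L).Nonempty → ∀ᶠ n in Filter.atTop, (F n ∩ U).Nonempty) ∧
  (∀ K : Set Y, IsCompact K → K ∩ L = ∅ → ∀ᶠ n in Filter.atTop, F n ∩ K = ∅)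

/-- Membership in `C₀(Y)⁺`: continuous, nonnegative, vanishing at infinity. -/
def C0Plus {Y : Type u} [TopologicalSpace Y] (f : Y → ℝ) : Prop :=
  Continuous f ∧ (∀ y, 0 ≤ f y) ∧ ∀ ε : ℝ, 0 < ε → IsCompact {y | ε ≤ f y}

/-- `f^♯(y) = sup { f w : q w = q y }`. -/
noncomputable def fSharp {Y : Type u} {X : Type v} (q : Y → X) (f : Y → ℝ) (y : Y) : ℝ :=
  sSup (f '' (q ⁻¹' {q y}))

/-- `f^♭(x) = sup { f y : y ∈ q⁻¹(x) }`. -/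
noncomputable def fFlat {Y : Type u} {X : Type v} (q : Y → X) (f : Y → ℝ) (x : X) : ℝ :=
  sSup (f '' (q ⁻¹' {x}))

/-- Property (a). -/
def PropertyA {X : Type v} [TopologicalSpace X] (E : Set X) : Prop :=
  ∀ (x : ℕ → X) (x₀ : X), (∀ m, x m ∈ E) → Function.Injective x →
    Filter.Tendsto x Filter.atTop (nhds x₀) →
    ∃ φ : ℕ → ℕ, StrictMono φ ∧
      ∀ z : ℕ → ℕ → X, (∀ n, Filter.Tendsto (z n) Filter.atTop (nhds (x (φ n)))) →
        ∃ k : ℕ → ℕ, IsCompact (closure {p : X | ∃ n j, k n ≤ j ∧ z n j = p})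

/-- Property (b). -/
def PropertyB {X : Type v} [TopologicalSpace X] (E : Set X) : Prop :=
  ∀ (x : ℕ → X) (x₀ : X), Function.Injective x →
    Filter.Tendsto x Filter.atTop (nhds x₀) →
    ∃ φ : ℕ → ℕ, StrictMono φ ∧
      ∃ z : ℕ → ℕ → X, (∀ n j, z n j ∈ E) ∧
        (∀ n, Filter.Tendsto (z n) Filter.atTop (nhds (x (φ n)))) ∧
        ∀ js : ℕ → ℕ, Filter.Tendsto (fun n => z n (js n)) Filter.atTop (nhds x₀)

theorem aux_lift {Y : Type u} {X : Type v} [MetricSpace Y] [TopologicalSpace X] [T2Space X]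
    (q : Y → X) (hq : IsQuotMap q) (f : ℕ → X) (x : X) (hf : Tendsto f atTop (𝓝 x)) :
    ∃ φ : ℕ → ℕ, StrictMono φ ∧ ∃ (w : ℕ → Y) (y : Y), q y = x ∧ (∀ n, q (w n) = f (φ n)) ∧
      Tendsto w atTop (𝓝 y) := by
  obtain ⟨hs, hc, ho⟩ := hq
  by_cases hfr : ∃ᶠ n in atTop, f n = x
  · obtain ⟨φ, hφ, h⟩ := extraction_of_frequently_atTop hfr
    obtain ⟨y, hy⟩ := hs x
    exact ⟨φ, hφ, fun _ => y, y, hy, fun n => by rw [hy, h n], tendsto_const_nhds⟩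
  · rw [not_frequently] at hfr
    obtain ⟨N, hN⟩ := eventually_atTop.1 hfr
    set A : Set X := f '' Ici N with hA
    have hxA : x ∉ A := by
      rintro ⟨n, hn, h⟩
      exact hN n hn h
    have hxc : x ∈ closure A := mem_closure_of_tendsto hf
      ((eventually_ge_atTop N).mono fun n hn => ⟨n, hn, rfl⟩)
    have hnA : ¬ IsClosed (q ⁻¹' A) := by
      intro h
      have : IsClosed A := by
        rw [← isOpen_compl_iff, ho, preimage_compl]
        exact h.isOpen_compl
      exact hxA (this.closure_eq ▸ hxc)
    have hins : IsClosed (insert x A) := by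
      have h1 : IsCompact (insert x (range fun n => f (n + N))) :=
        (hf.comp (tendsto_add_atTop_nat N)).isCompact_insert_range
      have h2 : (range fun n => f (n + N)) = A := by
        ext p
        constructor
        · rintro ⟨n, rfl⟩
          exact ⟨n + N, by simp, rfl⟩
        · rintro ⟨n, hn, rfl⟩
          exact ⟨n - N, by simp [Nat.sub_add_cancel (mem_Ici.1 hn)]⟩
      rw [h2] at h1
      exact h1.isClosed
    obtain ⟨y, hy, hyA⟩ : ∃ y, y ∈ closure (q ⁻¹' A) ∧ y ∉ q ⁻¹' A := by
      by_contra! h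
      exact hnA (closure_subset_iff_isClosed.1 h)
    have hyx : q y = x := by
      have : y ∈ q ⁻¹' (insert x A) :=
        closure_minimal (preimage_mono (subset_insert _ _)) (hins.preimage hc) hy
      rcases this with h | h
      · exact h
      · exact absurd h hyA
    obtain ⟨w, hw, hwy⟩ := mem_closure_iff_seq_limit.1 hy
    choose m hm hmw using hw
    have hmt : Tendsto m atTop atTop := by
      rw [tendsto_atTop]
      intro M
      have hfin : IsClosed (f '' Ico N M) := ((finite_Ico N M).image f).isClosed
      have hnot : q y ∈ (f '' Ico N M)ᶜ := by
        rintro ⟨i, hi, h⟩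
        exact hN i hi.1 (h.trans hyx)
      have := ((hc.tendsto y).comp hwy).eventually (hfin.isOpen_compl.mem_nhds hnot)
      filter_upwards [this] with k hk
      by_contra hlt
      exact hk ⟨m k, ⟨hm k, not_le.1 hlt⟩, hmw k⟩
    obtain ⟨ψ, hψ, hψ2⟩ := strictMono_subseq_of_tendsto_atTop hmt
    exact ⟨m ∘ ψ, hψ2, w ∘ ψ, y, hyx, fun n => (hmw (ψ n)).symm, hwy.comp hψ.tendsto_atTop⟩

theorem aux_eventually {Y : Type u} {X : Type v} [MetricSpace Y] [TopologicalSpace X] [T2Space X]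
    (q : Y → X) (hq : IsQuotMap q) (y : Y) (hy : SingletonFibre q y) (C : Set Y) (hC : C ∈ 𝓝 y)
    (f : ℕ → X) (hf : Tendsto f atTop (𝓝 (q y))) : ∀ᶠ n in atTop, f n ∈ q '' C := by
  by_contra h
  rw [not_eventually] at h
  obtain ⟨φ, hφ, h⟩ := extraction_of_frequently_atTop h
  obtain ⟨ψ, hψ, w, y', hy', hw, ht⟩ := aux_lift q hq (f ∘ φ) _ (hf.comp hφ.tendsto_atTop)
  have : y' = y := by
    have h2 : y' ∈ q ⁻¹' {q y} := hy'
    rw [hy] at h2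
    exact h2
  subst this
  obtain ⟨n, hn⟩ := (ht.eventually hC).exists
  exact h (ψ n) ⟨w n, hn, hw n⟩

theorem aux_dense {Y : Type u} {X : Type v} [MetricSpace Y] [LocallyCompactSpace Y]
    [SeparableSpace Y] [TopologicalSpace X] [T2Space X]
    (q : Y → X) (hq : IsQuotMap q) (hirr : IsIrreducibleMap q) :
    Dense {y : Y | SingletonFibre q y} := by
  obtain ⟨hs, hc, ho⟩ := hq
  have : SecondCountableTopology Y := UniformSpace.secondCountable_of_separable Y
  let P : Set (Set Y × Set Y) := {p | p ∈ countableBasis Y ×ˢ countableBasis Y ∧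
    IsCompact (closure p.2) ∧ Disjoint (closure p.1) (closure p.2)}
  have hP : P.Countable :=
    ((countable_countableBasis Y).prod (countable_countableBasis Y)).mono fun p hp => hp.1
  let F : Set Y × Set Y → Set Y := fun p => closure p.1 ∩ q ⁻¹' (q '' closure p.2)
  have hcl : ∀ p ∈ P, IsClosed (F p) := fun p hp =>
    isClosed_closure.inter ((hp.2.1.image hc).isClosed.preimage hc)
  have hd : Dense (⋂ p ∈ P, (F p)ᶜ) := by
    refine dense_biInter_of_isOpen (fun p hp => (hcl p hp).isOpen_compl) hP ?_
    intro p hp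
    rw [← interior_eq_empty_iff_dense_compl]
    have h := hirr (interior (F p))ᶜ isOpen_interior.isClosed_compl ?_
    · rwa [compl_univ_iff] at h
    · rw [eq_univ_iff_forall]
      intro x
      obtain ⟨y, rfl⟩ := hs x
      by_cases hy : y ∈ interior (F p)
      · obtain ⟨_, l, hl, hlq⟩ := interior_subset hy
        refine ⟨l, fun hl2 => ?_, hlq⟩
        exact disjoint_left.1 hp.2.2 (interior_subset hl2).1 hl
      · exact ⟨y, hy, rfl⟩
  refine hd.mono ?_
  intro y hy
  simp only [mem_iInter] at hy
  change q ⁻¹' {q y} = {y}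
  refine Subset.antisymm ?_ (by rintro _ rfl; rfl)
  intro y' hy'
  by_contra hne
  have hne : y ≠ y' := fun h => hne h.symm
  obtain ⟨U, hU, V, hV, hUV⟩ := (disjoint_nhds_nhds.2 hne) |> Filter.disjoint_iff.1
  obtain ⟨K, hK, hKU, hKc⟩ := local_compact_nhds hU
  obtain ⟨L, hL, hLV, hLc⟩ := local_compact_nhds hV
  obtain ⟨B, hB, hyB, hBK⟩ := (isBasis_countableBasis Y).mem_nhds_iff.1 hK
  obtain ⟨B', hB', hyB', hBL⟩ := (isBasis_countableBasis Y).mem_nhds_iff.1 hL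
  have h1 : closure B ⊆ K := closure_minimal hBK hKc.isClosed
  have h2 : closure B' ⊆ L := closure_minimal hBL hLc.isClosed
  exact hy (B, B') ⟨⟨hB, hB'⟩, hLc.of_isClosed_subset isClosed_closure h2,
    hUV.mono (h1.trans hKU) (h2.trans hLV)⟩
    ⟨subset_closure hyB, y', subset_closure hyB', hy'⟩

theorem statement_16 {Y : Type u} {X : Type v} [MetricSpace Y] [LocallyCompactSpace Y]
    [SeparableSpace Y] [TopologicalSpace X] [T2Space X]
    (q : Y → X) (hq : IsQuotMap q) (hirr : IsIrreducibleMap q)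
    (E : Set X) (hE : E = q '' {y : Y | SingletonFibre q y}) :
    SeqDense E ∧ (∀ x ∈ E, CompactType x) ∧ PropertyA E ∧ PropertyB E := by
  subst hE
  have hd := aux_dense q hq hirr
  have hc := hq.2.1
  refine ⟨?_, ?_, ?_, ?_⟩
  · intro x
    obtain ⟨y, rfl⟩ := hq.1 x
    obtain ⟨w, hw, hwy⟩ := mem_closure_iff_seq_limit.1 (hd y)
    exact ⟨q ∘ w, fun n => ⟨w n, hw n, rfl⟩, (hc.tendsto y).comp hwy⟩
  · rintro _ ⟨y, hy, rfl⟩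
    obtain ⟨C, hCc, hC⟩ := exists_compact_mem_nhds y
    exact ⟨q '' C, hCc.image hc, fun f hf => aux_eventually q hq y hy C hC f hf⟩
  · intro x x₀ hx _ ht
    obtain ⟨φ, hφ, w, y, rfl, hw, hwy⟩ := aux_lift q hq x x₀ ht
    obtain ⟨C, hCc, hC⟩ := exists_compact_mem_nhds y
    obtain ⟨N, hN⟩ := eventually_atTop.1 (hwy.eventually (eventually_mem_nhds_iff.2 hC))
    refine ⟨fun n => φ (n + N), fun a b hab => hφ (by omega), ?_⟩
    intro z hz
    have key : ∀ n, ∃ k, ∀ j ≥ k, z n j ∈ q '' C := by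
      intro n
      have hsf : SingletonFibre q (w (n + N)) := by
        obtain ⟨s, hs, hsx⟩ := hx (φ (n + N))
        have h1 : w (n + N) ∈ q ⁻¹' {q s} := by
          change q _ = q s
          rw [hw, hsx]
        rw [show q ⁻¹' {q s} = {s} from hs] at h1
        rw [show w (n + N) = s from h1]
        exact hs
      refine eventually_atTop.1 (aux_eventually q hq _ hsf C (hN _ (by omega)) (z n) ?_)
      rw [hw]
      exact hz n
    choose k hk using key
    refine ⟨k, (hCc.image hc).of_isClosed_subset isClosed_closure
      (closure_minimal ?_ (hCc.image hc).isClosed)⟩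
    rintro _ ⟨n, j, hj, rfl⟩
    exact hk n j hj
  · intro x x₀ _ ht
    obtain ⟨φ, hφ, w, y, rfl, hw, hwy⟩ := aux_lift q hq x x₀ ht
    have key : ∀ n j : ℕ, ∃ s, SingletonFibre q s ∧
        dist (w n) s < 1 / ((n : ℝ) + 1) * (1 / ((j : ℝ) + 1)) := fun n j =>
      Metric.dense_iff.1 hd (w n) (1 / ((n : ℝ) + 1) * (1 / ((j : ℝ) + 1))) (by positivity) |>.imp fun s hs =>
        ⟨hs.2, by rw [dist_comm]; exact hs.1⟩
    choose s hs hsd using key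
    have hle : ∀ j : ℕ, 1 / ((j : ℝ) + 1) ≤ 1 := fun j => by
      rw [div_le_one (by positivity)]
      linarith [(Nat.cast_nonneg j : (0 : ℝ) ≤ j)]
    have hlim := tendsto_one_div_add_atTop_nhds_zero_nat (𝕜 := ℝ)
    refine ⟨φ, hφ, fun n j => q (s n j), fun n j => ⟨_, hs n j, rfl⟩, ?_, ?_⟩
    · intro n
      rw [← hw]
      refine (hc.tendsto _).comp ?_
      rw [tendsto_iff_dist_tendsto_zero]
      refine squeeze_zero (fun _ => dist_nonneg) (fun j => ?_) hlim
      rw [dist_comm]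
      exact (hsd n j).le.trans (mul_le_of_le_one_left (by positivity) (hle n))
    · intro js
      refine (hc.tendsto _).comp ?_
      refine tendsto_of_tendsto_of_dist hwy ?_
      refine squeeze_zero (fun _ => dist_nonneg) (fun n => ?_) hlim
      exact (hsd n (js n)).le.trans (mul_le_of_le_one_right (by positivity) (hle _))
end

section
/- Let Y be a compact metric space and q : Y → X a quotient map with X Hausdorff. For each continuous f : Y → ℝ with f ≥ 0, define f^♭ : X → ℝ by f^♭(x) = sup{f(y) : y ∈ q⁻¹(x)}. Then each f^♭ is upper semicontinuous on X, and there is a dense G_δ subset B of X such that for every continuous f : Y → ℝ with f ≥ 0, the function f^♭ is continuous at every point of B. -/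
open Filter Topology Set TopologicalSpace

universe u v w

theorem statement_18 {Y : Type u} {X : Type v} [MetricSpace Y] [CompactSpace Y]
    [TopologicalSpace X] [T2Space X] (q : Y → X) (hq : IsQuotMap q) :
    (∀ f : Y → ℝ, Continuous f → (∀ y, 0 ≤ f y) → UpperSemicontinuous (fFlat q f)) ∧
    ∃ B : Set X, Dense B ∧ IsGδ B ∧
      ∀ f : Y → ℝ, Continuous f → (∀ y, 0 ≤ f y) →
        ∀ x ∈ B, ContinuousAt (fFlat q f) x := by
  obtain ⟨hsurj, hcont, -⟩ := hq
  haveI : CompactSpace X := hsurj.compactSpace hcont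
  have hclosed : IsClosedMap q := hcont.isClosedMap
  have bdd : ∀ f : Y → ℝ, Continuous f → ∀ x, BddAbove (f '' (q ⁻¹' {x})) := fun f hf x =>
    (((isClosed_singleton.preimage hcont).isCompact).image hf).bddAbove
  have att : ∀ f : Y → ℝ, Continuous f → ∀ x, ∃ y, q y = x ∧ f y = fFlat q f x := by
    intro f hf x
    have hne : (f '' (q ⁻¹' {x})).Nonempty := by
      obtain ⟨y, hy⟩ := hsurj x
      exact ⟨f y, y, hy, rfl⟩
    obtain ⟨y, hy, h⟩ :=
      (((isClosed_singleton.preimage hcont).isCompact).image hf).sSup_mem hne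
    exact ⟨y, hy, h⟩
  have ge : ∀ f : Y → ℝ, Continuous f → ∀ y, f y ≤ fFlat q f (q y) := fun f hf y =>
    le_csSup (bdd f hf _) ⟨y, rfl, rfl⟩
  have usc : ∀ f : Y → ℝ, Continuous f → UpperSemicontinuous (fFlat q f) := by
    intro f hf x a hxa
    have hC : IsClosed (q '' {y | a ≤ f y}) := hclosed _ (isClosed_le continuous_const hf)
    have hx : x ∈ (q '' {y | a ≤ f y})ᶜ := by
      rintro ⟨y, hy, rfl⟩
      exact absurd (le_trans hy (ge f hf y)) (not_le.2 hxa)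
    filter_upwards [hC.isOpen_compl.mem_nhds hx] with z hz
    obtain ⟨y, rfl, h⟩ := att f hf z
    rw [← h]
    by_contra hlt
    exact hz ⟨y, not_lt.1 hlt, rfl⟩
  refine ⟨fun f hf _ => usc f hf, ?_⟩
  have hcount := countable_countableBasis Y
  have hF : ∀ U : Set Y, IsClosed (q '' closure U) := fun U => hclosed _ isClosed_closure
  refine ⟨⋂ U ∈ countableBasis Y, (frontier (q '' closure U))ᶜ, ?_, ?_, ?_⟩
  · refine dense_biInter_of_isOpen (fun U _ => isClosed_frontier.isOpen_compl) hcount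
      (fun U _ => ?_)
    exact interior_eq_empty_iff_dense_compl.1 (interior_frontier (hF U))
  · exact IsGδ.biInter_of_isOpen hcount (fun U _ => isClosed_frontier.isOpen_compl)
  · intro f hf _ x hx
    refine continuousAt_iff_lower_upperSemicontinuousAt.2 ⟨?_, usc f hf x⟩
    intro a hxa
    obtain ⟨y, rfl, h⟩ := att f hf x
    have hay : {y | a < f y} ∈ 𝓝 y :=
      (isOpen_lt continuous_const hf).mem_nhds (by rw [← h] at hxa; exact hxa)
    obtain ⟨U, hU, hyU, hUs⟩ := (isBasis_countableBasis Y).exists_closure_subset hay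
    have hnf : q y ∉ frontier (q '' closure U) := by
      simpa using Set.mem_iInter₂.1 hx U hU
    have hin : q y ∈ interior (q '' closure U) := by
      by_contra hni
      exact hnf ⟨subset_closure ⟨y, subset_closure hyU, rfl⟩, hni⟩
    filter_upwards [mem_interior_iff_mem_nhds.1 hin] with z hz
    obtain ⟨w, hw, rfl⟩ := hz
    exact lt_of_lt_of_le (hUs hw) (ge f hf w)
end

section
/- Let Y be a standard space and q : Y → X a quotient map with X Hausdorff, and let L be the set of points of X that possess a compact neighbourhood. Then the set of points x ∈ L with the property that for every sequence (x_k) in X with x_k → x, the sequence of fibres (q⁻¹(x_k)) converges to q⁻¹(x) in the Fell topology, is dense in L. -/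
open Filter Topology Set TopologicalSpace

universe u v w

theorem statement_19 {Y : Type u} {X : Type v} [MetricSpace Y] [LocallyCompactSpace Y]
    [SeparableSpace Y] [TopologicalSpace X] [T2Space X]
    (q : Y → X) (hq : IsQuotMap q)
    (L : Set X) (hL : L = {x : X | ∃ K : Set X, IsCompact K ∧ K ∈ nhds x}) :
    ∀ x ∈ L, x ∈ closure {x' : X | x' ∈ L ∧
      ∀ xs : ℕ → X, Filter.Tendsto xs Filter.atTop (nhds x') →
        FellConv (fun k => q ⁻¹' {xs k}) (q ⁻¹' {x'})} := by
  subst hL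
  rintro x ⟨K, hK, hKx⟩
  have hqc : Continuous q := hq.2.1
  rw [mem_closure_iff]
  intro V hV hxV
  haveI : SecondCountableTopology Y := UniformSpace.secondCountable_of_separable Y
  haveI : CompactSpace K := isCompact_iff_compactSpace.mp hK
  let S : Set (Set Y) := {B | B ∈ countableBasis Y ∧ IsCompact (closure B)}
  have hS : S.Countable := (countable_countableBasis Y).mono fun B hB => hB.1
  let D : Set Y → Set X := fun B => (frontier (q '' closure B))ᶜ ∪ (closure (interior K))ᶜ
  have hDo : ∀ B ∈ S, IsOpen ((Subtype.val : K → X) ⁻¹' D B) := fun B _ =>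
    (isClosed_frontier.isOpen_compl.union isClosed_closure.isOpen_compl).preimage
      continuous_subtype_val
  have hDd : ∀ B ∈ S, Dense ((Subtype.val : K → X) ⁻¹' D B) := by
    intro B hB k
    rw [mem_closure_iff]
    intro O hO hkO
    obtain ⟨G, hG, rfl⟩ := isOpen_induced_iff.mp hO
    by_cases hk : (k : X) ∈ closure (interior K)
    · have hne := mem_closure_iff.mp hk G hG hkO
      have hcl : IsClosed (q '' closure B) := (hB.2.image hqc).isClosed
      by_contra hcon
      have hsub : G ∩ interior K ⊆ frontier (q '' closure B) := by
        intro z hz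
        by_contra hzf
        exact hcon ⟨⟨z, interior_subset hz.2⟩, hz.1, Or.inl hzf⟩
      have := interior_maximal hsub (hG.inter isOpen_interior)
      rw [interior_frontier hcl] at this
      obtain ⟨z, hz⟩ := hne
      exact this hz
    · exact ⟨k, hkO, Or.inr hk⟩
  have hdense := dense_biInter_of_isOpen hDo hS hDd
  have hxK : x ∈ interior K := mem_interior_iff_mem_nhds.mpr hKx
  obtain ⟨k, hk1, hk2⟩ := mem_closure_iff.mp (hdense ⟨x, interior_subset hxK⟩)
    ((Subtype.val : K → X) ⁻¹' (V ∩ interior K))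
    ((hV.inter isOpen_interior).preimage continuous_subtype_val) ⟨hxV, hxK⟩
  refine ⟨k, hk1.1, ⟨K, hK, mem_interior_iff_mem_nhds.mp hk1.2⟩, ?_⟩
  intro xs hxs
  constructor
  · rintro U hU ⟨y, hyU, hyk⟩
    obtain ⟨C, hC, hyC, hCU⟩ := exists_compact_subset hU hyU
    obtain ⟨B, hB, hyB, hBC⟩ :=
      (isBasis_countableBasis Y).exists_subset_of_mem_open hyC isOpen_interior
    have hclB : closure B ⊆ C :=
      closure_minimal (hBC.trans interior_subset) hC.isClosed
    have hBS : B ∈ S := ⟨hB, hC.of_isClosed_subset isClosed_closure hclB⟩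
    have hkD : (k : X) ∈ D B := by
      have := mem_iInter₂.mp hk2 B hBS
      exact this
    have hkq : (k : X) ∈ q '' closure B := ⟨y, subset_closure hyB, hyk⟩
    have hkint : (k : X) ∈ interior (q '' closure B) := by
      rcases hkD with h | h
      · by_contra hn
        exact h ⟨subset_closure hkq, hn⟩
      · exact absurd (subset_closure hk1.2) h
    filter_upwards [hxs (mem_interior_iff_mem_nhds.mp hkint)] with n hn
    obtain ⟨w, hw, hwn⟩ := hn
    exact ⟨w, hwn, hCU (hclB hw)⟩
  · intro C hC hCe
    have hkn : (q '' C)ᶜ ∈ nhds (k : X) := by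
      refine (hC.image hqc).isClosed.isOpen_compl.mem_nhds ?_
      rintro ⟨y, hy, hyk⟩
      have : y ∈ C ∩ q ⁻¹' {(k : X)} := ⟨hy, hyk⟩
      rw [hCe] at this
      exact this
    filter_upwards [hxs hkn] with n hn
    ext w
    simp only [mem_inter_iff, mem_empty_iff_false, iff_false]
    rintro ⟨h1, h2⟩
    exact hn ⟨w, h2, h1⟩
end
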